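/- arXiv:math/0608203 — 5 statements merged into one kernel-verified Lean document; each statement's English description precedes it below -/
import Mathlib

section
/- Let p be a prime, A a commutative ring with p·1_A = 0, n ≥ 1 a natural number divisible by p, and u ∈ A. Set B = A[X]/(X^n − u) and let v be the image of X in B. Then the B-linear map B → Ω^1_{B/A} sending b to b • d(v) is an isomorphism; that is, Ω^1_{B/A} is a free B-module of rank one generated by d(v). (This is the local computation behind the statement that the covering Y = Spec_{O_X}(⊕_{i=0}^{n−1} L^i) → X attached to an n-torsion line bundle is étale if and only if p does not divide n.) -/
open Polynomial

/-- If `f` divides `derivative f`, then `derivative` descends to a derivation of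
`AdjoinRoot f` sending the root to `1`. -/
theorem AdjoinRoot.exists_derivation_root_eq_one {A : Type*} [CommRing A] {f : A[X]}
    (hf : f ∣ derivative f) :
    ∃ d : Derivation A (AdjoinRoot f) (AdjoinRoot f), d (AdjoinRoot.root f) = 1 := by
  refine ⟨Derivation.liftOfSurjective (f := AdjoinRoot.mkₐ f)
    (AdjoinRoot.mk_surjective (g := f)) (d := derivative') fun g hg ↦ ?_, ?_⟩
  · obtain ⟨g, rfl⟩ := AdjoinRoot.mk_eq_zero.mp hg
    refine AdjoinRoot.mk_eq_zero.mpr ?_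
    change f ∣ derivative (f * g)
    rw [derivative_mul]
    exact dvd_add (hf.mul_right g) (dvd_mul_right f _)
  · refine (Derivation.liftOfSurjective_apply (f := AdjoinRoot.mkₐ f) _ _ X).trans ?_
    change AdjoinRoot.mk f (derivative X) = 1
    rw [derivative_X, map_one]

/-- If `f` divides `derivative f`, then `Ω[AdjoinRoot f⁄A]` is free of rank one on the
differential of the root. -/
theorem KaehlerDifferential.bijective_toSpanSingleton_D_root {A : Type*} [CommRing A]
    {f : A[X]} (hf : f ∣ derivative f) :
    Function.Bijective
      (LinearMap.toSpanSingleton (AdjoinRoot f) (Ω[(AdjoinRoot f)⁄A])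
        (KaehlerDifferential.D A (AdjoinRoot f) (AdjoinRoot.root f))) := by
  constructor
  · obtain ⟨d, hd⟩ := AdjoinRoot.exists_derivation_root_eq_one hf
    refine Function.LeftInverse.injective (g := d.liftKaehlerDifferential) fun b ↦ ?_
    rw [LinearMap.toSpanSingleton_apply, map_smul, Derivation.liftKaehlerDifferential_comp_D,
      hd, smul_eq_mul, mul_one]
  · rw [← LinearMap.range_eq_top, eq_top_iff, ← KaehlerDifferential.span_range_derivation,
      Submodule.span_le]
    rintro _ ⟨b, rfl⟩
    obtain ⟨g, rfl⟩ := AdjoinRoot.mk_surjective b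
    rw [← AdjoinRoot.aeval_eq, Derivation.comp_aeval_eq]
    exact ⟨_, rfl⟩

/-- Let `p` be a prime, `A` a commutative ring with `p • 1 = 0`, `n ≥ 1`
divisible by `p`, and `u ∈ A`. Set `B = A[X]/(X ^ n - u)` and let `v` be the image of
`X`. Then the `B`-linear map `B → Ω[B⁄A]`, `b ↦ b • d v`, is an isomorphism, i.e.
`Ω[B⁄A]` is free of rank one generated by `d v`. -/
theorem kaehler_free_rank_one_of_char_dvd (p : ℕ) (hp : p.Prime) (A : Type*) [CommRing A]
    (hchar : (p : A) = 0) (n : ℕ) (hn1 : 1 ≤ n) (hpn : p ∣ n) (u : A) :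
    Function.Bijective
      (LinearMap.toSpanSingleton (AdjoinRoot (X ^ n - C u))
        (Ω[(AdjoinRoot (X ^ n - C u))⁄A])
        (KaehlerDifferential.D A (AdjoinRoot (X ^ n - C u))
          (AdjoinRoot.root (X ^ n - C u)))) := by
  have hn : (n : A[X]) = 0 := by
    obtain ⟨k, rfl⟩ := hpn
    rw [← map_natCast C, Nat.cast_mul, hchar, zero_mul, C_0]
  apply KaehlerDifferential.bijective_toSpanSingleton_D_root
  simp [derivative_X_pow, hn]
end

section
/- Let A be a commutative ring, n ≥ 1 a natural number that is invertible in A, and u a unit of A. Then B = A[X]/(X^n − u) is an étale A-algebra (i.e., formally étale and of finite presentation). (This is the 'if' direction of the claim that the algebra ⊕_{i=0}^{n−1} L^i attached to an n-torsion line bundle L is étale if and only if the characteristic does not divide n.) -/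
open Polynomial

/-- A monic separable polynomial defines an étale algebra. -/
theorem Polynomial.Separable.etale_adjoinRoot {R : Type*} [CommRing R] {f : R[X]}
    (hf : f.Separable) (hm : f.Monic) : Algebra.Etale R (AdjoinRoot f) := by
  obtain ⟨a, b, h⟩ := hf
  let P : StandardEtalePair R :=
    { f := f
      monic_f := hm
      g := 1
      cond := ⟨b, a, 1, by linear_combination h⟩ }
  let e : AdjoinRoot f ≃ₐ[AdjoinRoot f] Localization.Away (AdjoinRoot.mk f 1) :=
    IsLocalization.atUnit _ _ (AdjoinRoot.mk f 1) (by simp)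
  exact .of_equiv (P.equivAwayAdjoinRoot.trans (e.restrictScalars R).symm)

/-- Let `A` be a commutative ring, `n ≥ 1` invertible in `A`, and `u` a
unit of `A`. Then `B = A[X]/(X ^ n - u)` is an étale `A`-algebra. -/
theorem etale_of_isUnit_n (A : Type*) [CommRing A] (n : ℕ) (hn1 : 1 ≤ n)
    (hn : IsUnit (n : A)) (u : Aˣ) :
    Algebra.Etale A (AdjoinRoot (X ^ n - C (u : A))) :=
  (separable_X_pow_sub_C_unit u hn).etale_adjoinRoot
    (monic_X_pow_sub_C _ (Nat.one_le_iff_ne_zero.mp hn1))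
end

section
/- Let p be a prime, k a commutative ring, A a commutative k-algebra with p·1_A = 0, n ≥ 1 a natural number divisible by p, and u a unit of A. Set B = A[X]/(X^n − u). Then the kernel of the canonical map Ω^1_{A/k} → Ω^1_{B/k} (induced by the structure map A → B) is exactly the A-submodule of Ω^1_{A/k} generated by d(u). (This is the exactness assertion Ker(σ^*) = Im(·ω_L) in the four-term exact sequence 0 → O_X → Ω^1_X → Ω^1_L → O_X → 0 of Lemma 2.2, stated affine-locally; note A·du = A·(u⁻¹du) since u is a unit.) -/
open Polynomial

theorem AdjoinRoot.root_X_pow_sub_C_pow_eq {A : Type*} [CommRing A] (n : ℕ) (u : A) :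
    root (X ^ n - C u) ^ n = algebraMap A (AdjoinRoot (X ^ n - C u)) u := by
  have h := eval₂_root (X ^ n - C u)
  rwa [eval₂_sub, eval₂_X_pow, eval₂_C, sub_eq_zero] at h

/-- The ring homomorphism `a ↦ a + ε d(a)` into a trivial square-zero extension attached to a
derivation `d`. -/
def Derivation.toTrivSqZeroExt {k A N : Type*} (B : Type*) [CommRing k] [CommRing A] [CommRing B]
    [Algebra k A] [Algebra A B] [AddCommGroup N] [Module k N] [Module A N] [Module B N]
    [Module Bᵐᵒᵖ N] [IsCentralScalar B N] [IsScalarTower A B N] (d : Derivation k A N) :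
    A →+* TrivSqZeroExt B N where
  toFun a := TrivSqZeroExt.inl (algebraMap A B a) + TrivSqZeroExt.inr (d a)
  map_one' := by ext <;> simp
  map_zero' := by ext <;> simp
  map_add' a b := by ext <;> simp
  map_mul' a b := by ext <;> simp

/-- A derivation `d` of `A` with values in a module over `A[X]/(X ^ n - u)` extends to
`A[X]/(X ^ n - u)` as soon as it kills `u`, by declaring that `X` is constant. -/
theorem Derivation.exists_extension_adjoinRoot_X_pow_sub_C {k A N : Type*} [CommRing k]
    [CommRing A] [Algebra k A] [AddCommGroup N] (n : ℕ) (u : A) [Module k N] [Module A N]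
    [Module (AdjoinRoot (X ^ n - C u)) N] [IsScalarTower A (AdjoinRoot (X ^ n - C u)) N]
    [IsScalarTower k (AdjoinRoot (X ^ n - C u)) N] (d : Derivation k A N) (hd : d u = 0) :
    ∃ D : Derivation k (AdjoinRoot (X ^ n - C u)) N,
      ∀ a, D (algebraMap A (AdjoinRoot (X ^ n - C u)) a) = d a := by
  set B := AdjoinRoot (X ^ n - C u)
  let _ : Module Bᵐᵒᵖ N := Module.compHom N ((RingHom.id B).fromOpposite mul_comm)
  have : IsCentralScalar B N := ⟨fun _ _ => rfl⟩
  let f : A →+* TrivSqZeroExt B N := d.toTrivSqZeroExt B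
  have hroot : (TrivSqZeroExt.inl (AdjoinRoot.root (X ^ n - C u)) : TrivSqZeroExt B N) ^ n
      = f u := by
    rw [TrivSqZeroExt.inl_pow, AdjoinRoot.root_X_pow_sub_C_pow_eq]
    simp [f, Derivation.toTrivSqZeroExt, hd, B]
  let φ : B →+* TrivSqZeroExt B N := AdjoinRoot.lift f (TrivSqZeroExt.inl (AdjoinRoot.root _))
    (by simp [hroot])
  have hof (a : A) : φ (algebraMap A B a) = f a := AdjoinRoot.lift_of _
  have hfst (b : B) : (φ b).fst = b := by
    have : (TrivSqZeroExt.fstHom B B N : TrivSqZeroExt B N →+* B).comp φ = RingHom.id B := by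
      apply AdjoinRoot.ringHom_ext
      · ext a
        exact (congrArg TrivSqZeroExt.fst (hof a)).trans (by simp [f, Derivation.toTrivSqZeroExt, B])
      · exact congrArg TrivSqZeroExt.fst (AdjoinRoot.lift_root _)
    exact congr($this b)
  have hmul (a b : B) : (φ (a * b)).snd = a • (φ b).snd + b • (φ a).snd := by
    simp [hfst]
  refine ⟨Derivation.mk'
    { toFun := fun b => (φ b).snd
      map_add' := by simp
      map_smul' := fun c b => ?_ } hmul, fun a => (congrArg TrivSqZeroExt.snd (hof a)).trans (by simp [f, Derivation.toTrivSqZeroExt])⟩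
  have hc : (φ (algebraMap k B c)).snd = 0 := by
    rw [IsScalarTower.algebraMap_apply k A B, hof]
    simp [f, Derivation.toTrivSqZeroExt]
  simp only [RingHom.id_apply]
  rw [Algebra.smul_def, hmul, hc, smul_zero, add_zero, algebraMap_smul]

/-- Let `p` be a prime, `k` a commutative ring, `A` a commutative
`k`-algebra with `p • 1 = 0`, `n ≥ 1` divisible by `p`, and `u` a unit of `A`. Set
`B = A[X]/(X ^ n - u)`. Then the kernel of the canonical map `Ω[A⁄k] → Ω[B⁄k]` is
exactly the `A`-submodule generated by `d u`. -/
theorem ker_kaehler_map_eq_span_du (p : ℕ) (hp : p.Prime) (k A : Type*) [CommRing k]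
    [CommRing A] [Algebra k A] (hchar : (p : A) = 0) (n : ℕ) (hn1 : 1 ≤ n)
    (hpn : p ∣ n) (u : Aˣ) :
    LinearMap.ker
      (KaehlerDifferential.map k k A (AdjoinRoot (X ^ n - C (u : A)))) =
      Submodule.span A {KaehlerDifferential.D k A (u : A)} := by
  nontriviality A
  set B := AdjoinRoot (X ^ n - C (u : A))
  set S := Submodule.span A {KaehlerDifferential.D k A (u : A)} with hS
  apply le_antisymm
  · have hmonic : (X ^ n - C (u : A)).Monic := monic_X_pow_sub_C _ (by omega)
    have : Module.Free A B := hmonic.free_adjoinRoot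
    have : Nontrivial B := by
      refine Ideal.Quotient.nontrivial_iff.mpr fun h => ?_
      have h1 := hmonic.eq_one_of_isUnit (Ideal.span_singleton_eq_top.mp h)
      have h2 := natDegree_X_pow_sub_C (n := n) (r := (u : A))
      rw [h1, natDegree_one] at h2
      omega
    let q : Ω[A⁄k] →ₗ[A] TensorProduct A B (Ω[A⁄k] ⧸ S) :=
      TensorProduct.mk A B (Ω[A⁄k] ⧸ S) 1 ∘ₗ S.mkQ
    have hq (x) (hx : q x = 0) : x ∈ S := by
      have := Module.FaithfullyFlat.tensorProduct_mk_injective (A := A) (B := B) (Ω[A⁄k] ⧸ S)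
      rw [← S.ker_mkQ, LinearMap.mem_ker]
      apply this
      simpa [q] using hx
    obtain ⟨D, hD⟩ := Derivation.exists_extension_adjoinRoot_X_pow_sub_C n (u : A)
      (q.compDer (KaehlerDifferential.D k A)) (by
        change TensorProduct.mk A B _ 1 (S.mkQ (KaehlerDifferential.D k A (u : A))) = 0
        rw [Submodule.mkQ_apply, (Submodule.Quotient.mk_eq_zero S).mpr
          (Submodule.mem_span_singleton_self _), map_zero])
    have hcomp : D.liftKaehlerDifferential.restrictScalars A ∘ₗ KaehlerDifferential.map k k A B
        = q := by
      apply Derivation.liftKaehlerDifferential_unique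
      ext a
      change D.liftKaehlerDifferential
        (KaehlerDifferential.map k k A B (KaehlerDifferential.D k A a)) = _
      rw [KaehlerDifferential.map_D, Derivation.liftKaehlerDifferential_comp_D]
      exact hD a
    intro x hx
    apply hq
    rw [← hcomp, LinearMap.comp_apply, LinearMap.mem_ker.mp hx, map_zero]
  · rw [hS, Submodule.span_singleton_le_iff_mem, LinearMap.mem_ker, KaehlerDifferential.map_D]
    have hn : (n : B) = 0 := by
      obtain ⟨m, rfl⟩ := hpn
      rw [← map_natCast (algebraMap A B), Nat.cast_mul, hchar, zero_mul, map_zero]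
    rw [← AdjoinRoot.root_X_pow_sub_C_pow_eq, Derivation.leibniz_pow,
      ← Nat.cast_smul_eq_nsmul B, hn, zero_smul]
end

section
/- Let p be a prime, k a commutative ring, A a commutative k-algebra with p·1_A = 0, n ≥ 1 a natural number divisible by p, and u a unit of A. Set B = A[X]/(X^n − u) and let v be the image of X in B (a unit of B, with v⁻¹ = u⁻¹·v^{n−1}). If a ∈ A satisfies that a • (v⁻¹ • d(v)) lies in the range of the canonical map Ω^1_{A/k} → Ω^1_{B/k}, then a = 0. (This shows the surjection s: Ω^1_L → O_X with s(dv_α/v_α) = 1 in Lemma 2.2 is well defined and injective on the quotient by Im(Ω^1_X).) -/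
open Polynomial

/-- If `f` divides its derivative, then `d/dX` descends to `A[X]/(f)`. -/
theorem AdjoinRoot.exists_derivation_mk_eq {A : Type*} [CommRing A] {f : A[X]}
    (hf : f ∣ derivative f) :
    ∃ d : Derivation A (AdjoinRoot f) (AdjoinRoot f),
      ∀ g : A[X], d (AdjoinRoot.mk f g) = AdjoinRoot.mk f (derivative g) := by
  let π : A[X] →ₗ[A] AdjoinRoot f := (AdjoinRoot.mkₐ f).toLinearMap
  have hπ : Function.Surjective π := AdjoinRoot.mk_surjective
  have hker : LinearMap.ker π ≤ LinearMap.ker (π ∘ₗ derivative) := by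
    intro g hg
    obtain ⟨q, rfl⟩ := AdjoinRoot.mk_eq_zero.mp (LinearMap.mem_ker.mp hg)
    refine LinearMap.mem_ker.mpr (AdjoinRoot.mk_eq_zero.mpr ?_)
    rw [derivative_mul]
    exact dvd_add (hf.mul_right q) (dvd_mul_right f _)
  let D : AdjoinRoot f →ₗ[A] AdjoinRoot f :=
    (LinearMap.ker π).liftQ (π ∘ₗ derivative) hker ∘ₗ
      (π.quotKerEquivOfSurjective hπ).symm.toLinearMap
  have hD (g : A[X]) : D (AdjoinRoot.mk f g) = AdjoinRoot.mk f (derivative g) := by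
    have : (π.quotKerEquivOfSurjective hπ).symm (AdjoinRoot.mk f g) =
        (LinearMap.ker π).mkQ g :=
      (LinearEquiv.symm_apply_eq _).mpr rfl
    change (LinearMap.ker π).liftQ _ hker
      ((π.quotKerEquivOfSurjective hπ).symm (AdjoinRoot.mk f g)) = _
    rw [this]
    rfl
  refine ⟨Derivation.mk' D fun x y => ?_, hD⟩
  obtain ⟨g, rfl⟩ := AdjoinRoot.mk_surjective x
  obtain ⟨h, rfl⟩ := AdjoinRoot.mk_surjective y
  rw [← map_mul, hD, hD, hD, derivative_mul, map_add, map_mul, map_mul, smul_eq_mul, smul_eq_mul]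
  ring

/-- For `B` an `A`-algebra, `A`-linear derivations of `B` kill the image of `Ω[A⁄k]`. -/
theorem Derivation.liftKaehlerDifferential_restrictScalars_map {k A B M : Type*} [CommRing k]
    [CommRing A] [CommRing B] [Algebra k A] [Algebra k B] [Algebra A B] [IsScalarTower k A B]
    [AddCommGroup M] [Module k M] [Module A M] [Module B M] [IsScalarTower k A M]
    [IsScalarTower k B M] [IsScalarTower A B M] (d : Derivation A B M) (x : Ω[A⁄k]) :
    (d.restrictScalars k).liftKaehlerDifferential (KaehlerDifferential.map k k A B x) = 0 := by
  suffices ((d.restrictScalars k).liftKaehlerDifferential.restrictScalars A) ∘ₗ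
      KaehlerDifferential.map k k A B = 0 from LinearMap.congr_fun this x
  apply Derivation.liftKaehlerDifferential_unique
  ext y
  simp

/-- Let `p` be a prime, `k` a commutative ring, `A` a commutative
`k`-algebra with `p • 1 = 0`, `n ≥ 1` divisible by `p`, and `u` a unit of `A`. Set
`B = A[X]/(X ^ n - u)`, let `v` be the image of `X` (a unit of `B`, with inverse `w`).
If `a ∈ A` satisfies that `a • (v⁻¹ • d v)` lies in the range of the canonical map
`Ω[A⁄k] → Ω[B⁄k]`, then `a = 0`. -/
theorem smul_dlog_root_mem_range_iff_zero (p : ℕ) (hp : p.Prime) (k A : Type*)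
    [CommRing k] [CommRing A] [Algebra k A] (hchar : (p : A) = 0) (n : ℕ)
    (hn1 : 1 ≤ n) (hpn : p ∣ n) (u : Aˣ)
    (w : AdjoinRoot (X ^ n - C (u : A)))
    (hw : AdjoinRoot.root (X ^ n - C (u : A)) * w = 1) (a : A)
    (ha : a • (w • KaehlerDifferential.D k (AdjoinRoot (X ^ n - C (u : A)))
        (AdjoinRoot.root (X ^ n - C (u : A)))) ∈
      LinearMap.range
        (KaehlerDifferential.map k k A (AdjoinRoot (X ^ n - C (u : A))))) :
    a = 0 := by
  have hn : (n : A) = 0 := by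
    obtain ⟨m, rfl⟩ := hpn
    rw [Nat.cast_mul, hchar, zero_mul]
  have hf : derivative (X ^ n - C (u : A)) = 0 := by simp [derivative_X_pow, hn]
  obtain ⟨d, hd⟩ := AdjoinRoot.exists_derivation_mk_eq (hf ▸ dvd_zero (X ^ n - C (u : A)))
  have hroot : d (AdjoinRoot.root (X ^ n - C (u : A))) = 1 := by
    rw [← AdjoinRoot.mk_X, hd, derivative_X, map_one]
  obtain ⟨x, hx⟩ := ha
  have haw : a • w = 0 := by
    have := d.liftKaehlerDifferential_restrictScalars_map (k := k) x
    rwa [hx, LinearMap.map_smul_of_tower, map_smul, Derivation.liftKaehlerDifferential_comp_D,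
      Derivation.restrictScalars_apply, hroot, smul_eq_mul, mul_one] at this
  have ha0 : AdjoinRoot.mk (X ^ n - C (u : A)) (C a) = 0 := by
    rw [AdjoinRoot.mk_C, ← AdjoinRoot.algebraMap_eq, Algebra.algebraMap_eq_smul_one, ← hw,
      ← mul_smul_comm, haw, mul_zero]
  nontriviality A
  refine C_eq_zero.mp (by_contra fun hC => ?_)
  refine (monic_X_pow_sub_C (u : A) (by lia)).not_dvd_of_natDegree_lt hC ?_
    (AdjoinRoot.mk_eq_zero.mp ha0)
  rw [natDegree_C, natDegree_X_pow_sub_C]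
  exact hn1
end

section
/- Let p be a prime, k a commutative ring, A a commutative k-algebra with p·1_A = 0, n ≥ 1 a natural number divisible by p, and u a unit of A. Set B = A[X]/(X^n − u), let v be the image of X in B, and let Ω^1_L denote the A-submodule of Ω^1_{B/k} generated by the range of the canonical map Ω^1_{A/k} → Ω^1_{B/k} together with the element v⁻¹ • d(v). Then the quotient A-module Ω^1_L/(range of Ω^1_{A/k} → Ω^1_{B/k}) is free of rank one, generated by the class of v⁻¹ • d(v); i.e., there is an A-linear isomorphism from this quotient to A sending the class of v⁻¹ • d(v) to 1. (This is the exactness of Ω^1_X → Ω^1_L → O_X → 0 in Lemma 2.2, stated affine-locally.) -/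
open Polynomial

set_option maxHeartbeats 1000000
set_option synthInstance.maxHeartbeats 400000

/-- If a linear map `φ` kills `N` and `φ x` is torsion-free, then `(N + A x) / N` is free of
rank one on the class of `x`. -/
theorem Submodule.exists_quotient_sup_span_singleton_equiv {A M P : Type*} [CommRing A]
    [AddCommGroup M] [Module A M] [AddCommGroup P] [Module A P] (N L : Submodule A M) (x : M)
    (hL : L = N ⊔ Submodule.span A {x}) (hx : x ∈ L) (φ : M →ₗ[A] P)
    (hN : ∀ y ∈ N, φ y = 0) (hφ : ∀ a : A, a • φ x = 0 → a = 0) :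
    ∃ e : (L ⧸ N.comap L.subtype) ≃ₗ[A] A,
      e (Submodule.Quotient.mk (⟨x, hx⟩ : L)) = 1 := by
  let f : A →ₗ[A] (L ⧸ N.comap L.subtype) :=
    LinearMap.toSpanSingleton A _ (Submodule.Quotient.mk (⟨x, hx⟩ : L))
  have hf : Function.Bijective f := by
    refine ⟨(injective_iff_map_eq_zero f).2 fun a ha => hφ a ?_, fun q => ?_⟩
    · rw [LinearMap.toSpanSingleton_apply, ← Submodule.Quotient.mk_smul,
        Submodule.Quotient.mk_eq_zero] at ha
      simpa using hN _ ha
    · obtain ⟨⟨y, hy⟩, rfl⟩ := Submodule.Quotient.mk_surjective _ q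
      have hy' := hy
      rw [hL] at hy'
      obtain ⟨z, hz, c, hc, rfl⟩ := Submodule.mem_sup.1 hy'
      obtain ⟨a, rfl⟩ := Submodule.mem_span_singleton.1 hc
      refine ⟨a, ?_⟩
      rw [LinearMap.toSpanSingleton_apply, ← Submodule.Quotient.mk_smul,
        Submodule.Quotient.eq]
      simpa using hz
  refine ⟨(LinearEquiv.ofBijective f hf).symm, ?_⟩
  rw [LinearEquiv.symm_apply_eq]
  simp [f]

/-- When `n = 0` in `A`, the derivation `X d/dX` descends to `A[X] / (X ^ n - u)`. -/
theorem AdjoinRoot.exists_derivation_root_eq_root {A : Type*} [CommRing A] (n : ℕ)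
    (hn : (n : A) = 0) (u : A) :
    ∃ D : Derivation A (AdjoinRoot (X ^ n - C u)) (AdjoinRoot (X ^ n - C u)),
      D (AdjoinRoot.root (X ^ n - C u)) = AdjoinRoot.root (X ^ n - C u) := by
  let d : Derivation A A[X] A[X] := mkDerivation A (X : A[X])
  have hd : d (X ^ n - C u) = 0 := by
    simp [d, mkDerivation_apply, derivative_X_pow, hn]
  have hker : ∀ y, AdjoinRoot.mkₐ (X ^ n - C u) y = 0 →
      AdjoinRoot.mkₐ (X ^ n - C u) (d y) = 0 := by
    intro y hy
    obtain ⟨q, rfl⟩ := AdjoinRoot.mk_eq_zero.1 hy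
    refine AdjoinRoot.mk_eq_zero.2 ?_
    rw [Derivation.leibniz, hd, smul_zero, add_zero, smul_eq_mul]
    exact dvd_mul_right _ _
  refine ⟨Derivation.liftOfSurjective (f := AdjoinRoot.mkₐ (X ^ n - C u))
    AdjoinRoot.mk_surjective hker, ?_⟩
  refine (Derivation.liftOfSurjective_apply (f := AdjoinRoot.mkₐ (X ^ n - C u))
    AdjoinRoot.mk_surjective hker X).trans ?_
  rw [mkDerivation_X]
  rfl

theorem AdjoinRoot.of_injective_of_monic {A : Type*} [CommRing A] {f : A[X]} (hf : f.Monic)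
    (h : 0 < f.natDegree) : Function.Injective (AdjoinRoot.of f) := by
  refine (injective_iff_map_eq_zero _).2 fun a ha => ?_
  by_contra ha'
  refine hf.not_dvd_of_natDegree_lt (C_ne_zero.2 ha') ?_ (AdjoinRoot.mk_eq_zero.1 ha)
  rwa [natDegree_C]

/-- Let `p` be a prime, `k` a commutative ring, `A` a commutative
`k`-algebra with `p • 1 = 0`, `n ≥ 1` divisible by `p`, and `u` a unit of `A`. Set
`B = A[X]/(X ^ n - u)`, let `v` be the image of `X` (with inverse `w`), and let `ΩL` be
the `A`-submodule of `Ω[B⁄k]` generated by the range of the canonical map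
`Ω[A⁄k] → Ω[B⁄k]` together with `v⁻¹ • d v`. Then the quotient of `ΩL` by the range is
free of rank one on the class of `v⁻¹ • d v`: there is an `A`-linear isomorphism to `A`
sending this class to `1`. -/
theorem quotient_omegaL_free_rank_one (p : ℕ) (hp : p.Prime) (k A : Type*)
    [CommRing k] [CommRing A] [Algebra k A] (hchar : (p : A) = 0) (n : ℕ)
    (hn1 : 1 ≤ n) (hpn : p ∣ n) (u : Aˣ)
    (w : AdjoinRoot (X ^ n - C (u : A)))
    (hw : AdjoinRoot.root (X ^ n - C (u : A)) * w = 1)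
    (ΩL : Submodule A (Ω[(AdjoinRoot (X ^ n - C (u : A)))⁄k]))
    (hΩL : ΩL =
      LinearMap.range (KaehlerDifferential.map k k A (AdjoinRoot (X ^ n - C (u : A)))) ⊔
        Submodule.span A
          {w • KaehlerDifferential.D k (AdjoinRoot (X ^ n - C (u : A)))
            (AdjoinRoot.root (X ^ n - C (u : A)))})
    (hmem : w • KaehlerDifferential.D k (AdjoinRoot (X ^ n - C (u : A)))
        (AdjoinRoot.root (X ^ n - C (u : A))) ∈ ΩL) :
    ∃ e : (ΩL ⧸ Submodule.comap ΩL.subtype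
        (LinearMap.range
          (KaehlerDifferential.map k k A (AdjoinRoot (X ^ n - C (u : A)))))) ≃ₗ[A] A,
      e (Submodule.Quotient.mk
        (⟨w • KaehlerDifferential.D k (AdjoinRoot (X ^ n - C (u : A)))
            (AdjoinRoot.root (X ^ n - C (u : A))), hmem⟩ : ΩL)) = 1 := by
  have hn : (n : A) = 0 := by
    obtain ⟨m, rfl⟩ := hpn
    rw [Nat.cast_mul, hchar, zero_mul]
  obtain ⟨D, hD⟩ := AdjoinRoot.exists_derivation_root_eq_root n hn (u : A)
  let φ := (D.restrictScalars k).liftKaehlerDifferential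
  refine Submodule.exists_quotient_sup_span_singleton_equiv _ ΩL _ hΩL hmem
    (φ.restrictScalars A) ?_ ?_
  · rintro _ ⟨y, rfl⟩
    have hy : y ∈ Submodule.span A (Set.range (KaehlerDifferential.D k A)) := by
      rw [KaehlerDifferential.span_range_derivation]
      trivial
    induction hy using Submodule.span_induction with
    | mem y hy =>
      obtain ⟨a, rfl⟩ := hy
      rw [KaehlerDifferential.map_D, LinearMap.restrictScalars_apply,
        Derivation.liftKaehlerDifferential_comp_D]
      exact D.map_algebraMap a
    | zero => simp
    | add y z _ _ hy hz => rw [map_add, map_add, hy, hz, add_zero]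
    | smul a y _ hy => rw [map_smul, map_smul, hy, smul_zero]
  · intro a ha
    have hφ : φ (w • KaehlerDifferential.D k (AdjoinRoot (X ^ n - C (u : A)))
        (AdjoinRoot.root (X ^ n - C (u : A)))) = 1 := by
      rw [map_smul, Derivation.liftKaehlerDifferential_comp_D]
      change w • D _ = 1
      rw [hD, smul_eq_mul, mul_comm, hw]
    rw [LinearMap.restrictScalars_apply, hφ, ← Algebra.algebraMap_eq_smul_one] at ha
    nontriviality A
    refine (injective_iff_map_eq_zero _).1 (AdjoinRoot.of_injective_of_monic
      (monic_X_pow_sub_C (u : A) (by omega)) ?_) a ha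
    rw [natDegree_X_pow_sub_C]
    exact hn1
end
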